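/- arXiv:2003.08198 — 2 statements merged into one kernel-verified Lean document; each statement's English description precedes it below -/
import Mathlib

section
/- Let u ∈ H^2(T^d) and γ ∈ (2,∞] with 1/q = 1/2 + 1/γ. Then ‖∇u‖_{L^{2q}} ≤ C(d,q,γ) ‖Δu‖_{L^2}^{1/2} ‖u‖_{L^γ}^{1/2}. -/
open MeasureTheory Real ENNReal

/-- A fundamental domain for the torus `T^d = (ℝ/ℤ)^d`. -/
def torusBox (d : ℕ) : Set (EuclideanSpace ℝ (Fin d)) :=
  {x | ∀ i, x i ∈ Set.Ico (0:ℝ) 1}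

/-- The Laplacian of a function on `ℝ^d`. -/
noncomputable def lap {d : ℕ} (u : EuclideanSpace ℝ (Fin d) → ℝ)
    (x : EuclideanSpace ℝ (Fin d)) : ℝ :=
  ∑ i, fderiv ℝ (fun y => fderiv ℝ u y (EuclideanSpace.single i 1)) x
    (EuclideanSpace.single i 1)

/-- The squared length of the gradient of a function on `ℝ^d`. -/
noncomputable def gradSq {d : ℕ} (u : EuclideanSpace ℝ (Fin d) → ℝ)
    (x : EuclideanSpace ℝ (Fin d)) : ℝ :=
  ∑ i, (fderiv ℝ u x (EuclideanSpace.single i 1))^2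


namespace GN

abbrev E (d : ℕ) := EuclideanSpace ℝ (Fin d)

lemma box_eq (d : ℕ) : torusBox d = (@WithLp.ofLp 2 (Fin d → ℝ)) ⁻¹'
    (Set.univ.pi fun _ => Set.Ico (0:ℝ) 1) := by
  ext x; simp [torusBox]

lemma box_meas (d : ℕ) : MeasurableSet (torusBox d) := by
  rw [box_eq]
  exact (PiLp.volume_preserving_ofLp (Fin d)).measurable
    (MeasurableSet.univ_pi fun _ => measurableSet_Ico)

lemma box_sub (d : ℕ) : ∃ K : Set (E d), IsCompact K ∧ torusBox d ⊆ K := by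
  refine ⟨(WithLp.toLp 2) '' (Set.Icc (0 : Fin d → ℝ) 1), isCompact_Icc.image (PiLp.continuous_toLp 2 _), ?_⟩
  intro x hx
  exact ⟨x.ofLp, ⟨fun i => (hx i).1, fun i => (hx i).2.le⟩, rfl⟩

lemma integrable_of_cont {d : ℕ} {f : E d → ℝ} (hf : Continuous f) :
    Integrable f (volume.restrict (torusBox d)) := by
  obtain ⟨K, hK, hs⟩ := box_sub d
  exact (hf.continuousOn.integrableOn_compact hK).mono_set hs

lemma integral_box {d : ℕ} (f : E d → ℝ) :
    ∫ x in torusBox d, f x = ∫ y in Set.Icc (0 : Fin d → ℝ) 1, f (WithLp.toLp 2 y) := by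
  have h := (PiLp.volume_preserving_toLp (Fin d)).setIntegral_preimage_emb
    (MeasurableEquiv.toLp 2 (Fin d → ℝ)).measurableEmbedding f (torusBox d)
  rw [← h]
  have : (@WithLp.toLp 2 (Fin d → ℝ)) ⁻¹' (torusBox d) = Set.univ.pi fun _ => Set.Ico (0:ℝ) 1 := by
    ext x; simp [torusBox]
  rw [this]
  exact setIntegral_congr_set (Measure.univ_pi_Ico_ae_eq_Icc (f := fun _ => (0:ℝ)) (g := fun _ => 1))

lemma integral_deriv_zero {d : ℕ} (i : Fin d) (f : E d → ℝ) (f' : E d → (E d →L[ℝ] ℝ))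
    (hf : ∀ x, HasFDerivAt f (f' x) x)
    (hc : Continuous fun x => f' x (EuclideanSpace.single i 1))
    (hp : ∀ x, f (x + EuclideanSpace.single i 1) = f x) :
    ∫ x in torusBox d, f' x (EuclideanSpace.single i 1) = 0 := by
  rw [integral_box]
  cases d with
  | zero => exact i.elim0
  | succ n =>
  let L : (Fin (n+1) → ℝ) →L[ℝ] E (n+1) := (PiLp.continuousLinearEquiv 2 ℝ (fun _ : Fin (n+1) => ℝ)).symm
  have hL : ∀ y, L y = WithLp.toLp 2 y := fun y => rfl
  have hfc : Continuous f := continuous_iff_continuousAt.2 fun x => (hf x).continuousAt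
  have hsum : ∀ x, ∑ j, (if j = i then (f' (L x)).comp L else 0) (Pi.single j 1) =
      f' (L x) (EuclideanSpace.single i 1) := by
    intro x
    rw [Finset.sum_eq_single i]
    · simp [hL]
    · intro j _ hj; simp [hj]
    · simp
  have key := integral_divergence_of_hasFDerivAt_off_countable' (0 : Fin (n+1) → ℝ) 1
    (by intro j; simp) (fun j y => if j = i then f (L y) else 0)
    (fun j y => if j = i then (f' (L y)).comp L else 0) ∅ (by simp)
    (by
      intro j
      by_cases hj : j = i
      · simp only [hj, if_true]; exact (hfc.comp L.continuous).continuousOn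
      · simp only [hj, if_false]; exact continuousOn_const)
    (by
      intro x _ j
      by_cases hj : j = i
      · simp only [hj, if_true]; exact (hf (L x)).comp x L.hasFDerivAt
      · simp only [hj, if_false]; exact hasFDerivAt_const _ _)
    (by
      simp only [hsum]
      exact (hc.comp L.continuous).continuousOn.integrableOn_compact isCompact_Icc)
  simp only [hsum] at key
  simp only [hL] at key
  rw [key]
  apply Finset.sum_eq_zero
  intro j _
  by_cases hj : j = i
  · subst hj
    simp only [if_true, Pi.one_apply, Pi.zero_apply]
    rw [sub_eq_zero]
    congr 1
    ext y
    refine Eq.trans ?_ (hp _)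
    congr 1
    ext k
    rcases Fin.eq_self_or_eq_succAbove j k with rfl | ⟨k, rfl⟩
    · simp
    · simp
  · simp [hj]

/-- Directional derivative. -/
noncomputable def D {d : ℕ} (i : Fin d) (f : E d → ℝ) (x : E d) : ℝ :=
  fderiv ℝ f x (EuclideanSpace.single i 1)

def Per {d : ℕ} (f : E d → ℝ) : Prop := ∀ x i, f (x + EuclideanSpace.single i 1) = f x

lemma D_smooth {d : ℕ} (i : Fin d) {f : E d → ℝ} (hf : ContDiff ℝ (⊤ : ℕ∞) f) :
    ContDiff ℝ (⊤ : ℕ∞) (D i f) := by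
  unfold D
  exact (hf.fderiv_right (m := (⊤ : ℕ∞)) (by simp)).clm_apply contDiff_const

lemma D_per {d : ℕ} (i : Fin d) {f : E d → ℝ} (hf : Per f) : Per (D i f) := by
  intro x j
  unfold D
  rw [← fderiv_comp_add_right]
  congr 2
  ext y
  exact hf y j

lemma D_comm {d : ℕ} (i j : Fin d) {f : E d → ℝ} (hf : ContDiff ℝ (⊤ : ℕ∞) f) :
    D i (D j f) = D j (D i f) := by
  have hd : Differentiable ℝ (fderiv ℝ f) :=
    (hf.fderiv_right (m := (⊤ : ℕ∞)) (by simp)).differentiable (by simp)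
  have h : ∀ i j x, D i (D j f) x =
      fderiv ℝ (fderiv ℝ f) x (EuclideanSpace.single i 1) (EuclideanSpace.single j 1) := by
    intro i j x
    unfold D
    rw [fderiv_clm_apply (hd x) (by fun_prop)]
    simp
  ext x
  rw [h, h]
  exact (hf.contDiffAt.isSymmSndFDerivAt (by simpa using (by exact_mod_cast le_top : ((2:ℕ∞) : WithTop ℕ∞) ≤ ((⊤:ℕ∞) : WithTop ℕ∞)))) _ _

lemma ibp {d : ℕ} (i : Fin d) {f g : E d → ℝ} (hf : ContDiff ℝ (⊤ : ℕ∞) f)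
    (hg : ContDiff ℝ (⊤ : ℕ∞) g) (pf : Per f) (pg : Per g) :
    ∫ x in torusBox d, D i f x * g x = - ∫ x in torusBox d, f x * D i g x := by
  have h := integral_deriv_zero i (fun x => f x * g x) _
    (fun x => ((hf.differentiable (by simp) x).hasFDerivAt).mul
      ((hg.differentiable (by simp) x).hasFDerivAt))
    (by
      have := (D_smooth i hf).continuous
      have := (D_smooth i hg).continuous
      have := hf.continuous
      have := hg.continuous
      simp only [_root_.add_apply, _root_.smul_apply, smul_eq_mul]
      unfold D at *
      fun_prop)
    (fun x => by rw [pf, pg])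
  simp only [_root_.add_apply, _root_.smul_apply, smul_eq_mul] at h
  have i1 : Integrable (fun x => f x * D i g x) (volume.restrict (torusBox d)) :=
    integrable_of_cont (hf.continuous.mul (D_smooth i hg).continuous)
  have i2 : Integrable (fun x => g x * D i f x) (volume.restrict (torusBox d)) :=
    integrable_of_cont (hg.continuous.mul (D_smooth i hf).continuous)
  have h1 := integral_add i1 i2
  have h3 : ∫ x in torusBox d, (f x * D i g x + g x * D i f x) = 0 := h
  have h2 : ∫ x in torusBox d, D i f x * g x = ∫ x in torusBox d, g x * D i f x := by
    simp only [mul_comm]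
  rw [h2]
  linarith

lemma DD_le {d : ℕ} (i : Fin d) {u : E d → ℝ} (hu : ContDiff ℝ (⊤ : ℕ∞) u) (pu : Per u) :
    ∫ x in torusBox d, (D i (D i u) x)^2 ≤ ∫ x in torusBox d, (lap u x)^2 := by
  have hs : ∀ i j, ContDiff ℝ (⊤ : ℕ∞) (D i (D j u)) := fun i j => D_smooth i (D_smooth j hu)
  have h1 : ∀ i j, ∫ x in torusBox d, D i (D i u) x * D j (D j u) x =
      ∫ x in torusBox d, (D j (D i u) x)^2 := by
    intro i j
    rw [ibp i (D_smooth i hu) (hs j j) (D_per i pu) (D_per j (D_per j pu)),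
      D_comm i j (D_smooth j hu)]
    have := ibp j (D_smooth i hu) (hs i j) (D_per i pu) (D_per i (D_per j pu))
    rw [← this, D_comm i j hu]
    simp only [sq]
  have h2 : ∀ x, (lap u x)^2 = ∑ i, ∑ j, D i (D i u) x * D j (D j u) x := by
    intro x
    rw [← Finset.sum_mul_sum, sq]; rfl
  simp only [h2]
  have hint : ∀ i j, Integrable (fun x => D i (D i u) x * D j (D j u) x)
      (volume.restrict (torusBox d)) := fun i j =>
    integrable_of_cont ((hs i i).continuous.mul (hs j j).continuous)
  rw [integral_finsetSum _ (fun i _ => integrable_finsetSum _ fun j _ => hint i j)]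
  simp_rw [integral_finsetSum _ (fun j _ => hint _ j), h1]
  have nn : ∀ i j, 0 ≤ ∫ x in torusBox d, (D j (D i u) x)^2 := fun i j =>
    integral_nonneg fun x => sq_nonneg _
  calc _ ≤ ∑ j, ∫ x in torusBox d, (D j (D i u) x)^2 :=
        Finset.single_le_sum (f := fun j => ∫ x in torusBox d, (D j (D i u) x)^2)
          (fun j _ => nn i j) (Finset.mem_univ i)
    _ ≤ _ := Finset.single_le_sum (f := fun i => ∑ j, ∫ x in torusBox d, (D j (D i u) x)^2)
          (fun i _ => Finset.sum_nonneg fun j _ => nn i j) (Finset.mem_univ i)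

lemma hasDerivAt_phi (r : ℝ) (hr : 0 < r) (s : ℝ) :
    HasDerivAt (fun s : ℝ => s * |s| ^ r) ((r+1) * |s| ^ r) s := by
  rcases eq_or_ne s 0 with rfl | hs
  · rw [hasDerivAt_iff_tendsto_slope_zero]
    have h : Filter.Tendsto (fun t : ℝ => |t| ^ r) (nhdsWithin 0 {0}ᶜ) (nhds ((r+1) * |(0:ℝ)| ^ r)) := by
      have : Continuous fun t : ℝ => |t| ^ r := by
        exact continuous_abs.rpow_const fun x => Or.inr hr.le
      have h := this.tendsto 0
      simp only [abs_zero, Real.zero_rpow hr.ne', mul_zero] at h ⊢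
      exact h.mono_left nhdsWithin_le_nhds
    refine h.congr' ?_
    filter_upwards [self_mem_nhdsWithin] with t ht
    have : t ≠ 0 := ht
    simp [this]
  · have h := (hasDerivAt_id s).mul ((hasDerivAt_abs hs).rpow_const (p := r)
      (Or.inl (abs_ne_zero.2 hs)))
    refine h.congr_deriv ?_
    simp only [id]
    have h1 : |s| ^ r = |s| ^ (r-1) * |s| := by
      rw [← Real.rpow_add_one (abs_ne_zero.2 hs)]; simp
    have h2 : s * (SignType.sign s : ℝ) = |s| := by
      rw [mul_comm]; exact sign_mul_self s
    calc _ = |s|^r + r * (|s| ^ (r-1) * (s * (SignType.sign s : ℝ))) := by ring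
      _ = _ := by rw [h2, ← h1]; ring

lemma DD_norm {d : ℕ} (i : Fin d) {u : E d → ℝ} (hu : ContDiff ℝ (⊤ : ℕ∞) u) (pu : Per u) :
    eLpNorm (D i (D i u)) 2 (volume.restrict (torusBox d)) ≤
      eLpNorm (fun x => lap u x) 2 (volume.restrict (torusBox d)) := by
  have hl : Continuous (fun x => lap u x) := by
    have : ∀ i, Continuous (D i (D i u)) := fun i => (D_smooth i (D_smooth i hu)).continuous
    exact continuous_finsetSum _ fun i _ => this i
  have h : ∀ f : E d → ℝ, Continuous f → eLpNorm f 2 (volume.restrict (torusBox d)) =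
      (ENNReal.ofReal (∫ x in torusBox d, (f x)^2)) ^ ((1:ℝ)/2) := by
    intro f hf
    rw [eLpNorm_eq_lintegral_rpow_enorm_toReal (by simp) (by simp),
      ofReal_integral_eq_lintegral_ofReal (f := fun x => (f x)^2) (integrable_of_cont (hf.pow 2))
        (Filter.Eventually.of_forall fun x => sq_nonneg _)]
    simp only [ENNReal.toReal_ofNat]
    congr 2
    ext x
    rw [← ofReal_norm, ENNReal.ofReal_rpow_of_nonneg (by positivity) (by positivity)]
    simp
  rw [h _ (D_smooth i (D_smooth i hu)).continuous, h _ hl]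
  exact ENNReal.rpow_le_rpow (ENNReal.ofReal_le_ofReal (DD_le i hu pu)) (by norm_num)

lemma est {d : ℕ} {γ q : ℝ≥0∞} (hγ : 2 < γ) (hq : q⁻¹ = 2⁻¹ + γ⁻¹) (i : Fin d) {u : E d → ℝ}
    (hu : ContDiff ℝ (⊤ : ℕ∞) u) (pu : Per u) :
    eLpNorm (D i u) (2 * q) (volume.restrict (torusBox d)) ≤
      (ENNReal.ofReal (2 * q.toReal - 1)) ^ ((1:ℝ)/2) *
      (eLpNorm (fun x => lap u x) 2 (volume.restrict (torusBox d))) ^ ((1:ℝ)/2) *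
      (eLpNorm u γ (volume.restrict (torusBox d))) ^ ((1:ℝ)/2) := by
  set μ := volume.restrict (torusBox d) with hμ
  have hqtop : q ≠ ⊤ := by
    rintro rfl
    have h := hq.symm
    simp at h
  have hq1 : 1 < q := by
    rw [← ENNReal.inv_lt_inv, hq, inv_one]
    have : γ⁻¹ < 2⁻¹ := ENNReal.inv_lt_inv.2 hγ
    calc (2⁻¹ : ℝ≥0∞) + γ⁻¹ < 2⁻¹ + 2⁻¹ := ENNReal.add_lt_add_left (by simp) this
      _ = 1 := ENNReal.inv_two_add_inv_two
  obtain ⟨Q, rfl⟩ : ∃ Q : ℝ, q = ENNReal.ofReal Q := ⟨q.toReal, (ENNReal.ofReal_toReal hqtop).symm⟩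
  have hQ : 1 < Q := by
    rw [← ENNReal.ofReal_one] at hq1
    exact (ENNReal.ofReal_lt_ofReal_iff_of_nonneg zero_le_one).1 hq1
  rw [ENNReal.toReal_ofReal (by linarith)]
  set r := 2 * Q - 2 with hr
  have hr0 : 0 < r := by linarith
  set v := D i u with hv
  set w := D i v with hw
  have sv : ContDiff ℝ (⊤ : ℕ∞) v := D_smooth i hu
  have cv : Continuous v := sv.continuous
  have cw : Continuous w := (D_smooth i sv).continuous
  have cu := hu.continuous
  have cvr : Continuous fun x => |v x| ^ r := cv.abs.rpow_const fun x => Or.inr hr0.le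
  have c2Q : Continuous fun x => |v x| ^ (2*Q) := cv.abs.rpow_const fun x => Or.inr (by linarith)
  have h2q : 2 * ENNReal.ofReal Q = ENNReal.ofReal (2*Q) := by
    rw [ENNReal.ofReal_mul (by norm_num)]; simp
  have pow_eq : ∀ x, v x * |v x| ^ r * v x = |v x| ^ (2*Q) := by
    intro x
    rcases eq_or_ne (v x) 0 with h | h
    · rw [h]; simp; rw [Real.zero_rpow (by linarith)]
    · have : 2 * Q = r + 2 := by rw [hr]; ring
      rw [this, Real.rpow_add (abs_pos.2 h), Real.rpow_two, sq_abs]; ring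
  -- integration by parts
  have hI : ∫ x in torusBox d, |v x| ^ (2*Q) =
      ∫ x in torusBox d, (-(2*Q-1)) * (|v x| ^ r * (u x * w x)) := by
    have h := integral_deriv_zero i (fun x => u x * (v x * |v x| ^ r)) _
      (fun x => ((hu.differentiable (by simp) x).hasFDerivAt).mul
        ((hasDerivAt_phi r hr0 (v x)).comp_hasFDerivAt x
          ((sv.differentiable (by simp) x).hasFDerivAt)))
      (by
        simp only [_root_.add_apply, _root_.smul_apply, smul_eq_mul]
        exact (cu.mul ((continuous_const.mul cvr).mul cw)).add ((cv.mul cvr).mul cv))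
      (fun x => by rw [pu, show v (x + _) = v x from D_per i pu x i])
    simp only [_root_.add_apply, _root_.smul_apply, smul_eq_mul] at h
    have h' : ∫ x in torusBox d, (u x * ((r+1) * |v x| ^ r * w x) + v x * |v x| ^ r * v x) = 0 := h
    have i1 : Integrable (fun x => u x * ((r+1) * |v x| ^ r * w x)) μ :=
      integrable_of_cont (cu.mul ((continuous_const.mul cvr).mul cw))
    have i2 : Integrable (fun x => v x * |v x| ^ r * v x) μ :=
      integrable_of_cont ((cv.mul cvr).mul cv)
    rw [integral_add i1 i2] at h'
    simp only [pow_eq] at h'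
    rw [eq_neg_of_add_eq_zero_right h', ← integral_neg]
    congr 1
    ext x
    rw [hr]; ring
  set N := eLpNorm v (2 * ENNReal.ofReal Q) μ with hN
  have hNtop : N ≠ ⊤ := by
    rw [hN, h2q]
    have : MemLp v (ENNReal.ofReal (2*Q)) μ := by
      rw [← integrable_norm_rpow_iff cv.aestronglyMeasurable (by simp; linarith) ENNReal.ofReal_ne_top]
      rw [ENNReal.toReal_ofReal (by linarith)]
      exact integrable_of_cont c2Q
    exact this.2.ne
  have hNpow : N ^ (2*Q) = ENNReal.ofReal (∫ x in torusBox d, |v x| ^ (2*Q)) := by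
    rw [hN, h2q, eLpNorm_eq_lintegral_rpow_enorm_toReal (by simp; linarith) ENNReal.ofReal_ne_top,
      ENNReal.toReal_ofReal (by linarith), ← ENNReal.rpow_mul, one_div,
      inv_mul_cancel₀ (by linarith), ENNReal.rpow_one,
      ofReal_integral_eq_lintegral_ofReal (integrable_of_cont c2Q)
        (Filter.Eventually.of_forall fun x => by positivity)]
    congr 1
    ext x
    rw [← ofReal_norm, ENNReal.ofReal_rpow_of_nonneg (by positivity) (by linarith)]
    simp
  have hT1 : ENNReal.HolderTriple γ 2 (ENNReal.ofReal Q) := ⟨by rw [hq, add_comm]⟩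
  have hT2 : ENNReal.HolderTriple (ENNReal.ofReal (Q/(Q-1))) (ENNReal.ofReal Q) 1 := by
    have := (Real.HolderConjugate.conjExponent hQ).symm
    exact this.ennrealOfReal
  have hexp : ENNReal.ofReal (Q/(Q-1)) * ENNReal.ofReal r = 2 * ENNReal.ofReal Q := by
    rw [h2q, ← ENNReal.ofReal_mul (by apply div_nonneg <;> linarith)]
    congr 1
    rw [hr]
    have : Q - 1 ≠ 0 := by linarith
    field_simp
  have hmain : N ^ (2*Q) ≤ ENNReal.ofReal (2*Q-1) * (N ^ r * (eLpNorm u γ μ * eLpNorm w 2 μ)) := by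
    rw [hNpow, hI]
    calc _ ≤ ‖∫ x in torusBox d, (-(2*Q-1)) * (|v x| ^ r * (u x * w x))‖ₑ :=
          Real.ofReal_le_enorm _
      _ = ENNReal.ofReal (2*Q-1) * ‖∫ x in torusBox d, (|v x| ^ r * (u x * w x))‖ₑ := by
          rw [integral_const_mul, enorm_mul, enorm_neg, Real.enorm_of_nonneg (by linarith)]
      _ ≤ ENNReal.ofReal (2*Q-1) * eLpNorm ((fun x => |v x| ^ r) • (u • w)) 1 μ := by
          gcongr
          rw [eLpNorm_one_eq_lintegral_enorm]
          exact enorm_integral_le_lintegral_enorm _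
      _ ≤ ENNReal.ofReal (2*Q-1) * (eLpNorm (fun x => |v x| ^ r) (ENNReal.ofReal (Q/(Q-1))) μ *
            eLpNorm (u • w) (ENNReal.ofReal Q) μ) := by
          gcongr
          exact eLpNorm_smul_le_mul_eLpNorm (cu.smul cw).aestronglyMeasurable
            cvr.aestronglyMeasurable
      _ ≤ _ := by
          gcongr
          · have := eLpNorm_norm_rpow (p := ENNReal.ofReal (Q/(Q-1))) (μ := μ) v hr0
            rw [hexp] at this
            exact this.le
          · exact eLpNorm_smul_le_mul_eLpNorm cw.aestronglyMeasurable cu.aestronglyMeasurable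
  have hwL : eLpNorm w 2 μ ≤ eLpNorm (fun x => lap u x) 2 μ := DD_norm i hu pu
  rcases eq_or_ne N 0 with h0 | h0
  · rw [h0]; exact zero_le
  have hNr0 : N ^ r ≠ 0 := by simp [h0, hNtop]
  have hNrt : N ^ r ≠ ⊤ := by simp [h0, hNtop]
  have hsq : N ^ (2:ℝ) ≤ ENNReal.ofReal (2*Q-1) * eLpNorm (fun x => lap u x) 2 μ * eLpNorm u γ μ := by
    have h1 : N ^ r * N ^ (2:ℝ) = N ^ (2*Q) := by
      rw [← ENNReal.rpow_add _ _ h0 hNtop]; congr 1; rw [hr]; ring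
    rw [← ENNReal.mul_le_mul_iff_right hNr0 hNrt, h1]
    refine hmain.trans ?_
    calc _ ≤ ENNReal.ofReal (2*Q-1) * (N ^ r * (eLpNorm u γ μ * eLpNorm (fun x => lap u x) 2 μ)) := by
          gcongr
      _ = _ := by ring
  rw [← ENNReal.mul_rpow_of_nonneg _ _ (by norm_num), ← ENNReal.mul_rpow_of_nonneg _ _ (by norm_num)]
  calc N = (N ^ (2:ℝ)) ^ ((1:ℝ)/2) := by rw [← ENNReal.rpow_mul]; simp
    _ ≤ _ := by gcongr

end GN

/-- Gagliardo–Nirenberg interpolation on the torus: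
`‖∇u‖_{L^{2q}} ≤ C ‖Δu‖_{L²}^{1/2} ‖u‖_{L^γ}^{1/2}` with `1/q = 1/2 + 1/γ`, `γ ∈ (2,∞]`. -/
theorem stmt9 (d : ℕ) (γ q : ℝ≥0∞) (hγ : 2 < γ) (hq : q⁻¹ = 2⁻¹ + γ⁻¹) :
    ∃ C : ℝ≥0∞, 0 < C ∧ C ≠ ⊤ ∧
      ∀ u : EuclideanSpace ℝ (Fin d) → ℝ, ContDiff ℝ (⊤ : ℕ∞) u →
        (∀ x i, u (x + EuclideanSpace.single i 1) = u x) →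
        eLpNorm (fun x => Real.sqrt (gradSq u x)) (2 * q) (volume.restrict (torusBox d)) ≤
          C * (eLpNorm (fun x => lap u x) 2 (volume.restrict (torusBox d))) ^ ((1:ℝ)/2) *
            (eLpNorm u γ (volume.restrict (torusBox d))) ^ ((1:ℝ)/2) := by
  refine ⟨d * (ENNReal.ofReal (2 * q.toReal - 1)) ^ ((1:ℝ)/2) + 1, by simp, ?_, ?_⟩
  · refine ENNReal.add_ne_top.2 ⟨ENNReal.mul_ne_top (by simp) ?_, by simp⟩
    exact ENNReal.rpow_ne_top_of_nonneg (by norm_num) (by simp)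
  intro u hu pu
  have h2q : 1 ≤ 2 * q := by
    have : q⁻¹ ≤ 2 := by
      rw [hq]
      calc (2⁻¹ : ℝ≥0∞) + γ⁻¹ ≤ 1 + 1 := by
            gcongr
            · simp
            · rw [ENNReal.inv_le_one]; exact le_trans (by norm_num) hγ.le
        _ = 2 := by norm_num
    calc (1 : ℝ≥0∞) = 2 * 2⁻¹ := (ENNReal.mul_inv_cancel (by simp) (by simp)).symm
      _ ≤ 2 * q := by gcongr; exact ENNReal.inv_le_iff_inv_le.1 this
  calc _ ≤ eLpNorm (∑ i, fun x => ‖GN.D i u x‖) (2*q) (volume.restrict (torusBox d)) := by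
        apply eLpNorm_mono_real
        intro x
        rw [Real.norm_of_nonneg (Real.sqrt_nonneg _), Finset.sum_apply]
        refine Real.sqrt_le_iff.2 ⟨Finset.sum_nonneg fun i _ => norm_nonneg _, ?_⟩
        refine le_trans (le_of_eq ?_)
          (Finset.sum_sq_le_sq_sum_of_nonneg fun i _ => norm_nonneg (GN.D i u x))
        simp [gradSq, GN.D]
    _ ≤ ∑ i, eLpNorm (fun x => ‖GN.D i u x‖) (2*q) (volume.restrict (torusBox d)) :=
        eLpNorm_sum_le (fun i _ =>
          (GN.D_smooth i hu).continuous.norm.aestronglyMeasurable) h2q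
    _ ≤ ∑ _i : Fin d, (ENNReal.ofReal (2 * q.toReal - 1)) ^ ((1:ℝ)/2) *
      (eLpNorm (fun x => lap u x) 2 (volume.restrict (torusBox d))) ^ ((1:ℝ)/2) *
      (eLpNorm u γ (volume.restrict (torusBox d))) ^ ((1:ℝ)/2) := by
        refine Finset.sum_le_sum fun i _ => ?_
        rw [eLpNorm_norm]
        exact GN.est hγ hq i hu pu
    _ = (d * (ENNReal.ofReal (2 * q.toReal - 1)) ^ ((1:ℝ)/2)) *
      (eLpNorm (fun x => lap u x) 2 (volume.restrict (torusBox d))) ^ ((1:ℝ)/2) *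
      (eLpNorm u γ (volume.restrict (torusBox d))) ^ ((1:ℝ)/2) := by
        simp [mul_assoc]
    _ ≤ _ := by
        gcongr
        exact le_self_add
end

section
/- Let b ∈ L^∞([0,T], W^{1,p}(T^d,R^d)) be divergence free with p > 2, and let u^ν solve the advection-diffusion equation ∂_t u^ν + b·∇u^ν = νΔu^ν with u_0 ∈ W^{1,2}(T^d) ∩ L^∞. Then ν‖∇u^ν_t‖_{L^2}^2 + ν^2 ∫_0^t ‖Δu^ν_s‖_{L^2}^2 ds ≤ ν‖∇u_0‖_{L^2}^2 + C(d,p) ‖u_0‖_{L^∞}^{2/(p-1)} ‖∇b‖_{L^∞_t L^p_x}^{p/(p-1)} t^{1/(p-1)} ( ν ∫_0^t ‖∇u^ν_s‖_{L^2}^2 ds )^{(p-2)/(p-1)}. -/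
open MeasureTheory Real

namespace AD
variable {d : ℕ}

/-- Partial derivative. -/
noncomputable def dx (i : Fin d) (f : EuclideanSpace ℝ (Fin d) → ℝ)
    (x : EuclideanSpace ℝ (Fin d)) : ℝ := fderiv ℝ f x (EuclideanSpace.single i 1)

/-- Smooth periodic functions. -/
structure Per (f : EuclideanSpace ℝ (Fin d) → ℝ) : Prop where
  smooth : ContDiff ℝ (⊤ : ℕ∞) f
  per : ∀ x i, f (x + EuclideanSpace.single i 1) = f x

lemma Per.cont {f : EuclideanSpace ℝ (Fin d) → ℝ} (hf : Per f) : Continuous f :=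
  hf.smooth.continuous

lemma Per.diff {f : EuclideanSpace ℝ (Fin d) → ℝ} (hf : Per f) : Differentiable ℝ f :=
  hf.smooth.differentiable (by simp)

lemma Per.dx {f : EuclideanSpace ℝ (Fin d) → ℝ} (hf : Per f) (i : Fin d) : Per (dx i f) where
  smooth := by
    have h : ContDiff ℝ (⊤ : ℕ∞) (fderiv ℝ f) := hf.smooth.fderiv_right (by simp)
    exact h.clm_apply contDiff_const
  per := by
    intro x j
    have : (fun y => f (y + EuclideanSpace.single j 1)) = f := funext fun y => hf.per y j
    unfold AD.dx
    rw [← fderiv_comp_add_right, this]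

lemma Per.mul {f g : EuclideanSpace ℝ (Fin d) → ℝ} (hf : Per f) (hg : Per g) :
    Per (fun x => f x * g x) :=
  ⟨hf.smooth.mul hg.smooth, fun x i => by rw [hf.per, hg.per]⟩

lemma Per.add {f g : EuclideanSpace ℝ (Fin d) → ℝ} (hf : Per f) (hg : Per g) :
    Per (fun x => f x + g x) :=
  ⟨hf.smooth.add hg.smooth, fun x i => by rw [hf.per, hg.per]⟩

lemma Per.const (c : ℝ) : Per (fun _ : EuclideanSpace ℝ (Fin d) => c) :=
  ⟨contDiff_const, fun _ _ => rfl⟩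

lemma Per.sum {f : Fin d → EuclideanSpace ℝ (Fin d) → ℝ} (hf : ∀ i, Per (f i)) :
    Per (fun x => ∑ i, f i x) :=
  ⟨ContDiff.sum fun i _ => (hf i).smooth, fun x j => by
    exact Finset.sum_congr rfl fun i _ => (hf i).per x j⟩

lemma dx_mul {f g : EuclideanSpace ℝ (Fin d) → ℝ} (hf : Per f) (hg : Per g) (i : Fin d)
    (x : EuclideanSpace ℝ (Fin d)) :
    dx i (fun y => f y * g y) x = dx i f x * g x + f x * dx i g x := by
  unfold dx
  rw [fderiv_fun_mul (hf.diff x) (hg.diff x)]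
  simp; ring

lemma dx_sum {f : Fin d → EuclideanSpace ℝ (Fin d) → ℝ} (hf : ∀ i, Per (f i)) (i : Fin d)
    (x : EuclideanSpace ℝ (Fin d)) :
    dx i (fun y => ∑ j, f j y) x = ∑ j, dx i (f j) x := by
  unfold dx
  rw [fderiv_fun_sum (fun j _ => (hf j).diff x)]
  simp

lemma dx_comm {f : EuclideanSpace ℝ (Fin d) → ℝ} (hf : Per f) (i j : Fin d)
    (x : EuclideanSpace ℝ (Fin d)) : dx i (dx j f) x = dx j (dx i f) x := by
  have hs : IsSymmSndFDerivAt ℝ f x :=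
    (hf.smooth.contDiffAt).isSymmSndFDerivAt (by simp only [minSmoothness_of_isRCLikeNormedField]; exact WithTop.coe_le_coe.2 (le_top : (2 : ℕ∞) ≤ ⊤))
  have h : ContDiff ℝ (⊤ : ℕ∞) (fderiv ℝ f) := hf.smooth.fderiv_right (by simp)
  have hd : DifferentiableAt ℝ (fderiv ℝ f) x := h.differentiable (by simp) x
  have key : ∀ k l : Fin d, dx k (dx l f) x =
      fderiv ℝ (fderiv ℝ f) x (EuclideanSpace.single k 1) (EuclideanSpace.single l 1) := by
    intro k l
    unfold dx
    rw [fderiv_clm_apply hd (by fun_prop)]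
    simp
  rw [key, key, hs.eq]

/-- The closed box. -/
def cbox (d : ℕ) : Set (EuclideanSpace ℝ (Fin d)) := {x | ∀ i, x i ∈ Set.Icc (0:ℝ) 1}

lemma cbox_compact (d : ℕ) : IsCompact (cbox d) := by
  have h : cbox d = (EuclideanSpace.equiv (Fin d) ℝ).toHomeomorph ⁻¹'
      (Set.univ.pi fun _ => Set.Icc (0:ℝ) 1) := by
    ext x; simp only [cbox, Set.mem_preimage, Set.mem_pi, Set.mem_univ, true_imp_iff]; rfl
  rw [h, Homeomorph.isCompact_preimage]
  exact isCompact_univ_pi fun _ => isCompact_Icc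

lemma box_sub (d : ℕ) : torusBox d ⊆ cbox d := fun _ hx i => Set.Ico_subset_Icc_self (hx i)

lemma box_meas (d : ℕ) : MeasurableSet (torusBox d) := by
  have : torusBox d = ⋂ i, (fun x : EuclideanSpace ℝ (Fin d) => x i) ⁻¹' Set.Ico (0:ℝ) 1 := by
    ext x; simp [torusBox]
  rw [this]
  refine MeasurableSet.iInter fun i => ?_
  exact (by fun_prop : Measurable fun x : EuclideanSpace ℝ (Fin d) => x i) measurableSet_Ico

lemma box_int {f : EuclideanSpace ℝ (Fin d) → ℝ} (hf : Continuous f) :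
    IntegrableOn f (torusBox d) :=
  (hf.continuousOn.integrableOn_compact (cbox_compact d)).mono_set (box_sub d)

lemma box_eq (d : ℕ) (f : EuclideanSpace ℝ (Fin d) → ℝ) :
    ∫ x in torusBox d, f x = ∫ y in Set.Icc (0 : Fin d → ℝ) 1, f (WithLp.toLp 2 y) := by
  have h := (PiLp.volume_preserving_toLp (Fin d)).setIntegral_preimage_emb
    (MeasurableEquiv.toLp 2 (Fin d → ℝ)).measurableEmbedding f (torusBox d)
  rw [← h]
  have h2 : (WithLp.toLp 2 ⁻¹' (torusBox d) : Set (Fin d → ℝ)) =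
      Set.univ.pi fun i => Set.Ico ((0 : Fin d → ℝ) i) ((1 : Fin d → ℝ) i) := by
    ext x; simp [torusBox, Set.mem_pi]
  rw [h2]
  exact setIntegral_congr_set Measure.univ_pi_Ico_ae_eq_Icc

lemma int_dx {f : EuclideanSpace ℝ (Fin d) → ℝ} (hf : Per f) (i : Fin d) :
    ∫ x in torusBox d, dx i f x = 0 := by
  obtain _ | n := d
  · exact i.elim0
  rw [box_eq]
  let L := (EuclideanSpace.equiv (Fin (n+1)) ℝ).symm.toContinuousLinearMap
  have hL : ∀ y, L y = WithLp.toLp 2 y := fun y => rfl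
  have hc : Continuous (fun y : Fin (n+1) → ℝ => (WithLp.toLp 2 y : EuclideanSpace ℝ (Fin (n+1)))) :=
    L.continuous
  have hd : ∀ y, HasFDerivAt (fun y : Fin (n+1) → ℝ => f (WithLp.toLp 2 y))
      ((fderiv ℝ f (WithLp.toLp 2 y)).comp L) y := fun y =>
    (hf.diff (WithLp.toLp 2 y)).hasFDerivAt.comp y L.hasFDerivAt
  have hsum : ∀ x : Fin (n+1) → ℝ, (∑ j, (if j = i then (fderiv ℝ f (WithLp.toLp 2 x)).comp L else 0)
      (Pi.single j 1)) = dx i f (WithLp.toLp 2 x) := by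
    intro x
    rw [Finset.sum_eq_single i]
    · simp [dx, hL]
    · intro j _ hj; simp [hj]
    · simp
  have := integral_divergence_of_hasFDerivAt_off_countable' (0 : Fin (n+1) → ℝ) 1 zero_le_one
    (fun j y => if j = i then f (WithLp.toLp 2 y) else 0)
    (fun j y => if j = i then (fderiv ℝ f (WithLp.toLp 2 y)).comp L else 0) ∅ (by simp)
    (by
      intro j
      by_cases hj : j = i
      · simp only [hj, if_true]; exact (hf.cont.comp hc).continuousOn
      · simp only [hj, if_false]; exact continuousOn_const)
    (by
      intro x _ j
      by_cases hj : j = i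
      · simp only [hj, if_true]; exact hd x
      · simp only [hj, if_false]; exact hasFDerivAt_const _ _)
    (by
      simp only [hsum]
      exact (((hf.dx i).cont.comp hc).continuousOn).integrableOn_compact isCompact_Icc)
  simp only [hsum] at this
  rw [this]
  refine Finset.sum_eq_zero fun j _ => ?_
  rw [sub_eq_zero]
  by_cases hj : j = i
  · simp only [hj, if_true]
    congr 1
    ext x
    refine Eq.trans ?_ (hf.per _ i)
    congr 1
    ext k
    simp only [PiLp.add_apply, PiLp.single_apply]
    refine Fin.succAboveCases i ?_ (fun k => ?_) k
    · simp
    · simp [Fin.succAbove_ne]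
  · simp only [hj, if_false]

lemma ibp {f g : EuclideanSpace ℝ (Fin d) → ℝ} (hf : Per f) (hg : Per g) (i : Fin d) :
    ∫ x in torusBox d, dx i f x * g x = - ∫ x in torusBox d, f x * dx i g x := by
  have h := int_dx (hf.mul hg) i
  simp only [dx_mul hf hg] at h
  rw [integral_add (box_int ((hf.dx i).mul hg).cont) (box_int (hf.mul (hg.dx i)).cont)] at h
  linarith

lemma gradSq_eq (u : EuclideanSpace ℝ (Fin d) → ℝ) (x) : gradSq u x = ∑ i, dx i u x * dx i u x := by
  simp [gradSq, dx, sq]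

lemma lap_eq (u : EuclideanSpace ℝ (Fin d) → ℝ) (x) : lap u x = ∑ i, dx i (dx i u) x := rfl

lemma Per.gradSq {u : EuclideanSpace ℝ (Fin d) → ℝ} (hu : Per u) : Per (gradSq u) := by
  have := Per.sum fun i => (hu.dx i).mul (hu.dx i)
  convert this using 1
  exact funext fun x => gradSq_eq u x

lemma Per.lap {u : EuclideanSpace ℝ (Fin d) → ℝ} (hu : Per u) : Per (lap u) :=
  Per.sum fun i => (hu.dx i).dx i

lemma dx_gradSq {u : EuclideanSpace ℝ (Fin d) → ℝ} (hu : Per u) (i : Fin d) (x) :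
    dx i (gradSq u) x = 2 * ∑ j, dx j u x * dx i (dx j u) x := by
  have : (_root_.gradSq u) = fun y => ∑ j, dx j u y * dx j u y := funext fun x => gradSq_eq u x
  rw [this, dx_sum fun j => (hu.dx j).mul (hu.dx j), Finset.mul_sum]
  refine Finset.sum_congr rfl fun j _ => ?_
  rw [dx_mul (hu.dx j) (hu.dx j)]; ring

/-- `‖D²u‖ = ‖Δu‖`. -/
lemma hess_eq {u : EuclideanSpace ℝ (Fin d) → ℝ} (hu : Per u) :
    ∫ x in torusBox d, ∑ i, ∑ j, (dx i (dx j u) x)^2 = ∫ x in torusBox d, (lap u x)^2 := by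
  have h1 : ∀ x, (lap u x)^2 = ∑ i, ∑ j, dx i (dx i u) x * dx j (dx j u) x := by
    intro x; rw [lap_eq, sq, Finset.sum_mul_sum]
  simp only [h1, sq]
  have p := fun i j => (hu.dx j).dx i
  have i1 : ∀ i j, IntegrableOn (fun x => dx i (dx j u) x * dx i (dx j u) x) (torusBox d) :=
    fun i j => box_int ((p i j).mul (p i j)).cont
  have i2 : ∀ i j, IntegrableOn (fun x => dx i (dx i u) x * dx j (dx j u) x) (torusBox d) :=
    fun i j => box_int ((p i i).mul (p j j)).cont
  rw [integral_finsetSum _ fun i _ => integrable_finsetSum _ fun j _ => i1 i j,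
    integral_finsetSum _ fun i _ => integrable_finsetSum _ fun j _ => i2 i j]
  refine Finset.sum_congr rfl fun i _ => ?_
  rw [integral_finsetSum _ fun j _ => i1 i j, integral_finsetSum _ fun j _ => i2 i j]
  refine Finset.sum_congr rfl fun j _ => ?_
  have a := ibp (hu.dx j) (p i j) i
  have b := ibp (hu.dx j) (p i i) j
  rw [a]
  have : ∀ x, dx i (dx i u) x * dx j (dx j u) x = dx j (dx j u) x * dx i (dx i u) x :=
    fun x => mul_comm _ _
  simp only [this]
  rw [b]
  have hh : ∀ x, dx i (dx i (dx j u)) x = dx j (dx i (dx i u)) x := by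
    intro x
    have : dx i (dx j u) = dx j (dx i u) := funext fun y => dx_comm hu i j y
    rw [this, dx_comm (hu.dx i)]
  simp only [hh]

/-- Gagliardo–Nirenberg. -/
lemma gn {u : EuclideanSpace ℝ (Fin d) → ℝ} (hu : Per u) {M : ℝ} (hM : ∀ x, |u x| ≤ M) :
    ∫ x in torusBox d, (gradSq u x)^2 ≤ 10 * M^2 * ∫ x in torusBox d, (lap u x)^2 := by
  have hg := hu.gradSq
  have hl := hu.lap
  have p := fun i j => (hu.dx j).dx i
  have hH : Per (fun x => ∑ i, ∑ j, (dx i (dx j u) x)^2) := by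
    simp only [sq]
    exact Per.sum fun i => Per.sum fun j => (p i j).mul (p i j)
  -- divergence identity
  have hdiv : ∫ x in torusBox d, ∑ i, dx i (fun y => u y * (gradSq u y * dx i u y)) x = 0 := by
    rw [integral_finsetSum]
    · exact Finset.sum_eq_zero fun i _ => int_dx (hu.mul (hg.mul (hu.dx i))) i
    · intro i _
      exact box_int ((hu.mul (hg.mul (hu.dx i))).dx i).cont
  have hpt : ∀ x, ∑ i, dx i (fun y => u y * (gradSq u y * dx i u y)) x =
      (gradSq u x)^2 + u x * gradSq u x * lap u x
        + ∑ i, ∑ j, 2 * u x * dx i u x * dx j u x * dx i (dx j u) x := by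
    intro x
    have : ∀ i, dx i (fun y => u y * (gradSq u y * dx i u y)) x =
        (dx i u x * dx i u x) * gradSq u x + (u x * gradSq u x) * dx i (dx i u) x
          + ∑ j, 2 * u x * dx i u x * dx j u x * dx i (dx j u) x := by
      intro i
      rw [dx_mul hu (hg.mul (hu.dx i)), dx_mul hg (hu.dx i), dx_gradSq hu]
      have : ∑ j, 2 * u x * dx i u x * dx j u x * dx i (dx j u) x =
        2 * u x * dx i u x * ∑ j, dx j u x * dx i (dx j u) x := by
        rw [Finset.mul_sum]; exact Finset.sum_congr rfl fun j _ => by ring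
      rw [this]; ring
    simp only [this]
    rw [Finset.sum_add_distrib, Finset.sum_add_distrib, ← Finset.sum_mul, ← Finset.mul_sum,
      ← gradSq_eq, ← lap_eq, sq]
  have hle : ∀ x, (gradSq u x)^2 / 2 ≤ M^2 * (lap u x)^2
      + 4 * M^2 * ∑ i, ∑ j, (dx i (dx j u) x)^2
      + ∑ i, dx i (fun y => u y * (gradSq u y * dx i u y)) x := by
    intro x
    rw [hpt]
    have hu2 : u x ^ 2 ≤ M ^ 2 := sq_le_sq' (abs_le.1 (hM x)).1 (abs_le.1 (hM x)).2
    have h1 : -(u x * gradSq u x * lap u x) ≤ (gradSq u x)^2/4 + M^2 * (lap u x)^2 := by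
      nlinarith [sq_nonneg (gradSq u x / 2 + u x * lap u x),
        mul_le_mul_of_nonneg_right hu2 (sq_nonneg (lap u x))]
    have h2 : 0 ≤ (gradSq u x)^2/4 + 4 * M^2 * ∑ i, ∑ j, (dx i (dx j u) x)^2 +
       ∑ i, ∑ j, 2 * u x * dx i u x * dx j u x * dx i (dx j u) x := by
      rw [gradSq_eq, sq (∑ i, _), Finset.sum_mul_sum, Finset.sum_div, Finset.mul_sum,
        ← Finset.sum_add_distrib, ← Finset.sum_add_distrib]
      refine Finset.sum_nonneg fun i _ => ?_
      rw [Finset.sum_div, Finset.mul_sum,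
        ← Finset.sum_add_distrib, ← Finset.sum_add_distrib]
      refine Finset.sum_nonneg fun j _ => ?_
      nlinarith [sq_nonneg (dx i u x * dx j u x / 2 + 2 * u x * dx i (dx j u) x),
        mul_le_mul_of_nonneg_right hu2 (sq_nonneg (dx i (dx j u) x))]
    linarith
  have iD : IntegrableOn (fun x => ∑ i, dx i (fun y => u y * (gradSq u y * dx i u y)) x)
      (torusBox d) := 
    box_int (Per.sum fun i => (hu.mul (hg.mul (hu.dx i))).dx i).cont
  have iL : IntegrableOn (fun x => M^2 * (lap u x)^2) (torusBox d) :=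
    box_int (continuous_const.mul (hl.cont.pow 2))
  have iH : IntegrableOn (fun x => 4 * M^2 * ∑ i, ∑ j, (dx i (dx j u) x)^2) (torusBox d) :=
    box_int (continuous_const.mul hH.cont)
  have iG : IntegrableOn (fun x => (gradSq u x)^2 / 2) (torusBox d) :=
    box_int ((hg.cont.pow 2).div_const _)
  have iLH : IntegrableOn (fun x => M^2 * (lap u x)^2
      + 4 * M^2 * ∑ i, ∑ j, (dx i (dx j u) x)^2) (torusBox d) := iL.add iH
  have := setIntegral_mono iG (iLH.add iD) hle
  simp only [Pi.add_apply] at this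
  rw [integral_add iLH iD] at this
  rw [integral_add iL iH, hdiv, integral_const_mul, integral_const_mul, hess_eq hu, integral_div]
    at this
  linarith

/-- the commutator identity -/
lemma adv {u : EuclideanSpace ℝ (Fin d) → ℝ} (hu : Per u)
    {b : Fin d → EuclideanSpace ℝ (Fin d) → ℝ} (hb : ∀ i, Per (b i))
    (hdiv : ∀ x, ∑ i, dx i (b i) x = 0) :
    ∫ x in torusBox d, lap u x * ∑ j, b j x * dx j u x =
      - ∫ x in torusBox d, ∑ i, ∑ j, dx i u x * dx i (b j) x * dx j u x := by
  have hv : Per (fun x => ∑ j, b j x * dx j u x) := Per.sum fun j => (hb j).mul (hu.dx j)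
  have hg := hu.gradSq
  have p1 := fun i => ((hu.dx i).mul hv).dx i
  have p2 := fun j => ((hb j).mul hg).dx j
  have h1 : ∫ x in torusBox d, ∑ i, dx i (fun y => dx i u y * ∑ j, b j y * dx j u y) x = 0 := by
    rw [integral_finsetSum]
    · exact Finset.sum_eq_zero fun i _ => int_dx ((hu.dx i).mul hv) i
    · exact fun i _ => box_int (p1 i).cont
  have h2 : ∫ x in torusBox d, ∑ j, dx j (fun y => b j y * gradSq u y) x = 0 := by
    rw [integral_finsetSum]
    · exact Finset.sum_eq_zero fun i _ => int_dx ((hb i).mul hg) i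
    · exact fun i _ => box_int (p2 i).cont
  have hpt : ∀ x, lap u x * ∑ j, b j x * dx j u x =
      (∑ i, dx i (fun y => dx i u y * ∑ j, b j y * dx j u y) x
        - (1/2) * ∑ j, dx j (fun y => b j y * gradSq u y) x)
      - ∑ i, ∑ j, dx i u x * dx i (b j) x * dx j u x := by
    intro x
    have e2 : ∑ j, dx j (fun y => b j y * gradSq u y) x =
        2 * ∑ i, ∑ j, b j x * (dx i u x * dx j (dx i u) x) := by
      have : ∀ j, dx j (fun y => b j y * gradSq u y) x =
        dx j (b j) x * gradSq u x + 2 * ∑ i, b j x * (dx i u x * dx j (dx i u) x) := by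
        intro j
        rw [dx_mul (hb j) hg, dx_gradSq hu, ← Finset.mul_sum (Finset.univ) (fun i => dx i u x * dx j (dx i u) x)]; ring
      simp only [this]
      rw [Finset.sum_add_distrib, ← Finset.sum_mul, hdiv, ← Finset.mul_sum, zero_mul, zero_add,
        Finset.sum_comm]
    have e1 : ∀ i, dx i (fun y => dx i u y * ∑ j, b j y * dx j u y) x =
        dx i (dx i u) x * (∑ j, b j x * dx j u x) +
        (∑ j, dx i u x * dx i (b j) x * dx j u x + ∑ j, b j x * (dx i u x * dx j (dx i u) x)) := by
      intro i
      rw [dx_mul (hu.dx i) hv, dx_sum fun j => (hb j).mul (hu.dx j), ← Finset.sum_add_distrib]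
      refine congrArg₂ (· + ·) rfl ?_
      rw [Finset.mul_sum]
      refine Finset.sum_congr rfl fun j _ => ?_
      rw [dx_mul (hb j) (hu.dx j), dx_comm hu i j]; ring
    simp only [e1]
    rw [e2, Finset.sum_add_distrib, Finset.sum_add_distrib, ← Finset.sum_mul, ← lap_eq]
    ring
  have i1 := box_int (Per.sum p1).cont
  have i2 : IntegrableOn (fun x => (1/2) * ∑ j, dx j (fun y => b j y * gradSq u y) x) (torusBox d) :=
    box_int (continuous_const.mul (Per.sum p2).cont)
  have i3 : IntegrableOn (fun x => ∑ i, ∑ j, dx i u x * dx i (b j) x * dx j u x) (torusBox d) :=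
    box_int (Per.sum fun i => Per.sum fun j =>
      ((hu.dx i).mul ((hb j).dx i)).mul (hu.dx j)).cont
  simp only [hpt]
  have i12 : IntegrableOn (fun x => ∑ i, dx i (fun y => dx i u y * ∑ j, b j y * dx j u y) x
        - (1/2) * ∑ j, dx j (fun y => b j y * gradSq u y) x) (torusBox d) := i1.sub i2
  rw [integral_sub i12 i3]
  rw [integral_sub i1 i2, integral_const_mul, h1, h2]
  ring

/-- space partial derivative of a space-time function -/
noncomputable def sx (i : Fin d) (U : ℝ × EuclideanSpace ℝ (Fin d) → ℝ)
    (q : ℝ × EuclideanSpace ℝ (Fin d)) : ℝ := fderiv ℝ U q (0, EuclideanSpace.single i 1)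

/-- time partial derivative of a space-time function -/
noncomputable def st (U : ℝ × EuclideanSpace ℝ (Fin d) → ℝ)
    (q : ℝ × EuclideanSpace ℝ (Fin d)) : ℝ := fderiv ℝ U q (1, 0)

lemma sm_sx {U : ℝ × EuclideanSpace ℝ (Fin d) → ℝ} (hU : ContDiff ℝ (⊤ : ℕ∞) U) (i : Fin d) :
    ContDiff ℝ (⊤ : ℕ∞) (sx i U) := by
  have h : ContDiff ℝ (⊤ : ℕ∞) (fderiv ℝ U) := hU.fderiv_right (by simp)
  exact h.clm_apply contDiff_const

lemma sm_st {U : ℝ × EuclideanSpace ℝ (Fin d) → ℝ} (hU : ContDiff ℝ (⊤ : ℕ∞) U) :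
    ContDiff ℝ (⊤ : ℕ∞) (st U) := by
  have h : ContDiff ℝ (⊤ : ℕ∞) (fderiv ℝ U) := hU.fderiv_right (by simp)
  exact h.clm_apply contDiff_const

lemma st_hasDeriv {U : ℝ × EuclideanSpace ℝ (Fin d) → ℝ} (hU : ContDiff ℝ (⊤ : ℕ∞) U)
    (s : ℝ) (x : EuclideanSpace ℝ (Fin d)) :
    HasDerivAt (fun r => U (r, x)) (st U (s, x)) s := by
  have h1 : HasDerivAt (fun r : ℝ => (r, x)) ((1 : ℝ), (0 : EuclideanSpace ℝ (Fin d))) s :=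
    (hasDerivAt_id s).prodMk (hasDerivAt_const s x)
  exact (hU.differentiable (by simp) (s, x)).hasFDerivAt.comp_hasDerivAt s h1

lemma dx_sx {U : ℝ × EuclideanSpace ℝ (Fin d) → ℝ} (hU : ContDiff ℝ (⊤ : ℕ∞) U)
    (i : Fin d) (s : ℝ) (x : EuclideanSpace ℝ (Fin d)) :
    dx i (fun y => U (s, y)) x = sx i U (s, x) := by
  have h1 : HasFDerivAt (fun y : EuclideanSpace ℝ (Fin d) => (s, y))
      (ContinuousLinearMap.inr ℝ ℝ (EuclideanSpace ℝ (Fin d))) x := hasFDerivAt_prodMk_right s x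
  have h2 := (hU.differentiable (by simp) (s, x)).hasFDerivAt.comp x h1
  unfold dx sx
  have h3 : fderiv ℝ (fun y => U (s, y)) x = _ := h2.fderiv
  rw [h3]; simp

lemma st_sx {U : ℝ × EuclideanSpace ℝ (Fin d) → ℝ} (hU : ContDiff ℝ (⊤ : ℕ∞) U)
    (i : Fin d) (q) : st (sx i U) q = sx i (st U) q := by
  have hs : IsSymmSndFDerivAt ℝ U q :=
    (hU.contDiffAt).isSymmSndFDerivAt (by
      simp only [minSmoothness_of_isRCLikeNormedField]
      exact WithTop.coe_le_coe.2 (le_top : (2 : ℕ∞) ≤ ⊤))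
  have h : ContDiff ℝ (⊤ : ℕ∞) (fderiv ℝ U) := hU.fderiv_right (by simp)
  have hd : DifferentiableAt ℝ (fderiv ℝ U) q := h.differentiable (by simp) q
  have key : ∀ k l : ℝ × EuclideanSpace ℝ (Fin d), fderiv ℝ (fun r => fderiv ℝ U r l) q k =
      fderiv ℝ (fderiv ℝ U) q k l := by
    intro k l
    rw [fderiv_clm_apply hd (by fun_prop)]
    simp
  unfold st sx
  rw [key, key, hs.eq]

lemma reduce {f : EuclideanSpace ℝ (Fin d) → ℝ}
    (hf : ∀ x i, f (x + EuclideanSpace.single i 1) = f x) (x : EuclideanSpace ℝ (Fin d)) :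
    ∃ y ∈ cbox d, f y = f x := by
  have h1 : ∀ (i : Fin d) (n : ℤ) y, f (y + n • EuclideanSpace.single i (1:ℝ)) = f y := by
    intro i n y
    have : Function.Periodic f (EuclideanSpace.single i (1:ℝ)) := fun y => hf y i
    exact this.zsmul n y
  have h2 : ∀ (n : Fin d → ℤ) (S : Finset (Fin d)) y,
      f (y + ∑ i ∈ S, n i • EuclideanSpace.single i (1:ℝ)) = f y := by
    intro n S
    induction S using Finset.induction with
    | empty => simp
    | insert a S ha ih =>
      intro y
      rw [Finset.sum_insert ha, ← add_assoc, ih, h1]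
  refine ⟨_, ?_, h2 (fun i => -⌊x i⌋) Finset.univ x⟩
  intro i
  have : (x + ∑ j, (-⌊x j⌋) • EuclideanSpace.single j (1:ℝ)) i = Int.fract (x i) := by
    simp only [PiLp.add_apply, WithLp.ofLp_sum, Finset.sum_apply, PiLp.smul_apply,
      PiLp.single_apply]
    rw [Finset.sum_eq_single i]
    · simp [← sub_eq_add_neg]
    · intro j _ hj; simp [hj.symm]
    · simp
  rw [this]
  exact ⟨Int.fract_nonneg _, (Int.fract_lt_one _).le⟩

lemma snd_test {h : ℝ → ℝ} (hm : ∀ r, h r ≤ h 0) (hc : ContinuousAt h 0) :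
    deriv (deriv h) 0 ≤ 0 := by
  by_contra hcon
  push Not at hcon
  have hmax : IsLocalMax h 0 := Filter.Eventually.of_forall hm
  have hmin := isLocalMin_of_deriv_deriv_pos hcon hmax.deriv_eq_zero hc
  have he : h =ᶠ[nhds 0] fun _ => h 0 := by
    filter_upwards [hmin] with r hr using le_antisymm (hm r) hr
  have := he.deriv.deriv_eq
  simp at this
  linarith

lemma left_test {g : ℝ → ℝ} {g' t : ℝ} (ht : 0 < t) (hg : HasDerivAt g g' t)
    (hm : ∀ s ∈ Set.Icc 0 t, g s ≤ g t) : 0 ≤ g' := by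
  have h1 := (hasDerivWithinAt_iff_tendsto_slope' (by simp)).1 (hg.hasDerivWithinAt (s := Set.Iio t))
  refine ge_of_tendsto h1 ?_
  filter_upwards [Ioo_mem_nhdsLT ht] with s hs
  rw [slope_def_field]
  exact div_nonneg_of_nonpos (by linarith [hm s ⟨hs.1.le, hs.2.le⟩]) (by linarith [hs.2])

/-- Maximum principle. -/
lemma maxp {U : ℝ × EuclideanSpace ℝ (Fin d) → ℝ} (hU : ContDiff ℝ (⊤ : ℕ∞) U)
    (hper : ∀ s x i, U (s, x + EuclideanSpace.single i 1) = U (s, x))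
    {T ν M : ℝ} (hν : 0 < ν) (a : ℝ → EuclideanSpace ℝ (Fin d) → Fin d → ℝ)
    (heq : ∀ t ∈ Set.Icc 0 T, ∀ x, st U (t, x) + ∑ i, a t x i * sx i U (t, x) =
      ν * ∑ i, sx i (sx i U) (t, x))
    (h0 : ∀ x, U (0, x) ≤ M) : ∀ t ∈ Set.Icc 0 T, ∀ x, U (t, x) ≤ M := by
  intro t ht x
  have hT : 0 ≤ T := ht.1.trans ht.2
  refine le_of_forall_pos_le_add fun δ hδ => ?_
  obtain ⟨ε, hε, hεT⟩ : ∃ ε > 0, ε * T ≤ δ := by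
    refine ⟨δ / (T + 1), by positivity, ?_⟩
    rw [div_mul_eq_mul_div, div_le_iff₀ (by positivity)]
    nlinarith
  have hK : IsCompact (Set.Icc 0 T ×ˢ cbox d) := isCompact_Icc.prod (cbox_compact d)
  have hne : (Set.Icc 0 T ×ˢ cbox d).Nonempty :=
    ⟨(0, 0), ⟨le_refl _, hT⟩, fun i => by simp⟩
  have hc : Continuous (fun q : ℝ × EuclideanSpace ℝ (Fin d) => U q - ε * q.1) :=
    hU.continuous.sub (continuous_const.mul continuous_fst)
  obtain ⟨⟨t0, x0⟩, hmem, hmax⟩ := hK.exists_isMaxOn hne hc.continuousOn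
  have hall : ∀ s ∈ Set.Icc 0 T, ∀ y, U (s, y) - ε * s ≤ U (t0, x0) - ε * t0 := by
    intro s hs y
    obtain ⟨z, hz, hzy⟩ := reduce (f := fun y => U (s, y)) (fun x i => hper s x i) y
    have := hmax (Set.mk_mem_prod hs hz)
    rw [← hzy]; exact this
  have ht0 : t0 ∈ Set.Icc 0 T := hmem.1
  rcases eq_or_lt_of_le ht0.1 with h00 | hpos
  · have := hall t ht x
    rw [← h00] at this
    have h3 := h0 x0
    have : ε * t ≤ ε * T := mul_le_mul_of_nonneg_left ht.2 hε.le
    linarith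
  exfalso
  have e1 : 0 ≤ st U (t0, x0) - ε := by
    refine left_test (g := fun s => U (s, x0) - ε * s) hpos
      ((st_hasDeriv hU t0 x0).sub ?_) fun s hs => hall s ⟨hs.1, hs.2.trans ht0.2⟩ x0
    simpa using (hasDerivAt_id t0).const_mul ε
  have hmx : ∀ y, U (t0, y) ≤ U (t0, x0) := fun y => by linarith [hall t0 ht0 y]
  have e2 : ∀ i, sx i U (t0, x0) = 0 := by
    intro i
    rw [← dx_sx hU]
    have : IsLocalMax (fun y => U (t0, y)) x0 := Filter.Eventually.of_forall hmx
    unfold dx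
    rw [this.fderiv_eq_zero]; simp
  have hline : ∀ (V : ℝ × EuclideanSpace ℝ (Fin d) → ℝ), ContDiff ℝ (⊤ : ℕ∞) V → ∀ i r,
      HasDerivAt (fun r : ℝ => V (t0, x0 + r • EuclideanSpace.single i 1))
        (sx i V (t0, x0 + r • EuclideanSpace.single i 1)) r := by
    intro V hV i r
    have h2 : HasDerivAt (fun r : ℝ => x0 + r • EuclideanSpace.single i (1:ℝ))
        (EuclideanSpace.single i (1:ℝ)) r := by
      simpa using ((hasDerivAt_id r).smul_const (EuclideanSpace.single i (1:ℝ))).const_add x0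
    have h1 := (hasDerivAt_const r t0).prodMk h2
    exact (hV.differentiable (by simp) _).hasFDerivAt.comp_hasDerivAt r h1
  have e3 : ∀ i, sx i (sx i U) (t0, x0) ≤ 0 := by
    intro i
    have := snd_test (h := fun r : ℝ => U (t0, x0 + r • EuclideanSpace.single i 1))
      (fun r => by simpa using hmx _) (hline U hU i 0).continuousAt
    have hd : deriv (fun r : ℝ => U (t0, x0 + r • EuclideanSpace.single i 1)) =
        fun r => sx i U (t0, x0 + r • EuclideanSpace.single i 1) :=
      funext fun r => (hline U hU i r).deriv
    rw [hd, (hline _ (sm_sx hU i) i 0).deriv] at this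
    simpa using this
  have e4 := heq t0 ht0 x0
  simp only [e2, mul_zero, Finset.sum_const_zero, add_zero] at e4
  have : ν * ∑ i, sx i (sx i U) (t0, x0) ≤ 0 :=
    mul_nonpos_of_nonneg_of_nonpos hν.le (Finset.sum_nonpos fun i _ => e3 i)
  linarith

/-- space-time measure -/
noncomputable def stm (d : ℕ) (t : ℝ) : Measure (ℝ × EuclideanSpace ℝ (Fin d)) :=
  (volume.restrict (Set.Ioc 0 t)).prod (volume.restrict (torusBox d))

lemma stm_int {F : ℝ × EuclideanSpace ℝ (Fin d) → ℝ} (hF : Continuous F) (t : ℝ) :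
    Integrable F (stm d t) := by
  unfold stm
  rw [Measure.prod_restrict]
  refine IntegrableOn.mono_set (t := Set.Icc 0 t ×ˢ cbox d) ?_
    (Set.prod_mono Set.Ioc_subset_Icc_self (box_sub d))
  exact hF.continuousOn.integrableOn_compact (isCompact_Icc.prod (cbox_compact d))

lemma stm_eq {F : ℝ × EuclideanSpace ℝ (Fin d) → ℝ} (hF : Continuous F) {t : ℝ} (ht : 0 ≤ t) :
    ∫ s in (0:ℝ)..t, ∫ x in torusBox d, F (s, x) = ∫ q, F q ∂(stm d t) := by
  rw [intervalIntegral.integral_of_le ht]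
  exact (integral_prod F (stm_int hF t)).symm

lemma slice_int {F : ℝ × EuclideanSpace ℝ (Fin d) → ℝ} (hF : Continuous F) {t : ℝ} (ht : 0 ≤ t) :
    IntervalIntegrable (fun s => ∫ x in torusBox d, F (s, x)) volume 0 t := by
  rw [intervalIntegrable_iff_integrableOn_Ioc_of_le ht]
  exact (stm_int hF t).integral_prod_left

lemma ftc {G : ℝ × EuclideanSpace ℝ (Fin d) → ℝ} (hG : ContDiff ℝ (⊤ : ℕ∞) G) {t : ℝ}
    (ht : 0 ≤ t) :
    (∫ x in torusBox d, G (t, x)) - ∫ x in torusBox d, G (0, x) =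
      ∫ s in (0:ℝ)..t, ∫ x in torusBox d, st G (s, x) := by
  have hc := (sm_st hG).continuous
  rw [stm_eq hc ht]
  have h1 : ∫ q, st G q ∂(stm d t) = ∫ x in torusBox d, ∫ s in (0:ℝ)..t, st G (s, x) := by
    simp only [intervalIntegral.integral_of_le ht]
    exact integral_prod_symm _ (stm_int hc t)
  rw [h1, ← integral_sub (box_int (by fun_prop)) (box_int (by fun_prop))]
  congr 1
  ext x
  rw [intervalIntegral.integral_eq_sub_of_hasDerivAt (fun s _ => st_hasDeriv hG s x)]
  exact (hc.comp (by fun_prop : Continuous fun s : ℝ => (s, x))).intervalIntegrable _ _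

lemma holder3 {α : Type*} [MeasurableSpace α] {μ : Measure α} {f g h : α → ℝ}
    (hf : Integrable f μ) (hg : Integrable g μ) (hh : Integrable h μ)
    (f0 : ∀ x, 0 ≤ f x) (g0 : ∀ x, 0 ≤ g x) (h0 : ∀ x, 0 ≤ h x) {a b c : ℝ}
    (ha : 0 ≤ a) (hb : 0 ≤ b) (hc : 0 ≤ c) (habc : a + b + c = 1) :
    ∫ x, f x ^ a * g x ^ b * h x ^ c ∂μ ≤
      (∫ x, f x ∂μ) ^ a * (∫ x, g x ∂μ) ^ b * (∫ x, h x ∂μ) ^ c := by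
  have If : 0 ≤ ∫ x, f x ∂μ := integral_nonneg f0
  have Ig : 0 ≤ ∫ x, g x ∂μ := integral_nonneg g0
  have Ih : 0 ≤ ∫ x, h x ∂μ := integral_nonneg h0
  have key := ENNReal.lintegral_prod_norm_pow_le (μ := μ) (Finset.univ : Finset (Fin 3))
    (f := ![fun x => ENNReal.ofReal (f x), fun x => ENNReal.ofReal (g x),
      fun x => ENNReal.ofReal (h x)]) (p := ![a, b, c])
    (by
      intro i _
      fin_cases i
      · exact hf.aemeasurable.ennreal_ofReal
      · exact hg.aemeasurable.ennreal_ofReal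
      · exact hh.aemeasurable.ennreal_ofReal)
    (by simp [Fin.sum_univ_three, habc])
    (by intro i _; fin_cases i <;> simp [ha, hb, hc])
  simp only [Fin.prod_univ_three, Matrix.cons_val_zero, Matrix.cons_val_one, Matrix.cons_val] at key
  rw [← ofReal_integral_eq_lintegral_ofReal hf (Filter.Eventually.of_forall f0),
    ← ofReal_integral_eq_lintegral_ofReal hg (Filter.Eventually.of_forall g0),
    ← ofReal_integral_eq_lintegral_ofReal hh (Filter.Eventually.of_forall h0),
    ENNReal.ofReal_rpow_of_nonneg If ha, ENNReal.ofReal_rpow_of_nonneg Ig hb,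
    ENNReal.ofReal_rpow_of_nonneg Ih hc, ← ENNReal.ofReal_mul (by positivity),
    ← ENNReal.ofReal_mul (by positivity)] at key
  have hpt : ∀ x, ENNReal.ofReal (f x) ^ a * ENNReal.ofReal (g x) ^ b * ENNReal.ofReal (h x) ^ c =
      ENNReal.ofReal (f x ^ a * g x ^ b * h x ^ c) := by
    intro x
    have := f0 x
    have := g0 x
    have := h0 x
    rw [ENNReal.ofReal_rpow_of_nonneg (f0 x) ha, ENNReal.ofReal_rpow_of_nonneg (g0 x) hb,
      ENNReal.ofReal_rpow_of_nonneg (h0 x) hc, ← ENNReal.ofReal_mul (by positivity),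
      ← ENNReal.ofReal_mul (by positivity)]
  simp only [hpt] at key
  rw [integral_eq_lintegral_of_nonneg_ae]
  · exact ENNReal.toReal_le_of_le_ofReal (by positivity) key
  · refine Filter.Eventually.of_forall fun x => ?_
    have := f0 x
    have := g0 x
    have := h0 x
    simp only [Pi.zero_apply]
    positivity
  · have m1 := hf.aemeasurable
    have m2 := hg.aemeasurable
    have m3 := hh.aemeasurable
    exact ((m1.pow_const a).mul (m2.pow_const b)).mul (m3.pow_const c) |>.aestronglyMeasurable

lemma final_alg {p ν t B M N G Q L : ℝ} (hp : 2 < p) (hν : 0 < ν) (ht : 0 ≤ t) (hB : 0 ≤ B)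
    (hM : 0 ≤ M) (hN : 0 ≤ N) (hG : 0 ≤ G) (hQ : 0 ≤ Q) (hL : 0 ≤ L)
    (hNle : N ≤ t * B ^ p) (hQle : Q ≤ 10 * M ^ 2 * L) :
    2 * ν * (N ^ (1/p) * G ^ ((p-2)/p) * Q ^ (1/p)) ≤ ν ^ 2 * L +
      (2 * 10 ^ (1/p)) ^ (p/(p-1)) * M ^ (2/(p-1)) * B ^ (p/(p-1)) * t ^ (1/(p-1)) *
        (ν * G) ^ ((p-2)/(p-1)) := by
  have hp0 : 0 < p := by linarith
  have hp1 : 0 < p - 1 := by linarith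
  have hp2 : 0 < p - 2 := by linarith
  have c1 : N ^ (1/p) ≤ t ^ (1/p) * B := by
    refine (Real.rpow_le_rpow hN hNle (by positivity)).trans (le_of_eq ?_)
    rw [Real.mul_rpow ht (by positivity), ← Real.rpow_mul hB, mul_one_div_cancel hp0.ne',
      Real.rpow_one]
  have c2 : Q ^ (1/p) ≤ 10 ^ (1/p) * M ^ (2/p) * L ^ (1/p) := by
    refine (Real.rpow_le_rpow hQ hQle (by positivity)).trans (le_of_eq ?_)
    rw [Real.mul_rpow (by positivity) hL, Real.mul_rpow (by positivity) (by positivity),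
      ← Real.rpow_natCast_mul hM]
    congr 3
    push_cast; ring
  have c3 : (ν^2 * L) ^ (1/p) * (ν * G) ^ ((p-2)/p) = ν * (L ^ (1/p) * G ^ ((p-2)/p)) := by
    rw [Real.mul_rpow (by positivity) hL, Real.mul_rpow hν.le hG, ← Real.rpow_natCast_mul hν.le]
    have : ν ^ (((2:ℕ):ℝ) * (1/p)) * ν ^ ((p-2)/p) = ν := by
      rw [← Real.rpow_add hν]
      have : ((2:ℕ):ℝ) * (1/p) + (p-2)/p = 1 := by push_cast; field_simp; ring
      rw [this, Real.rpow_one]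
    linear_combination (L ^ (1/p) * G ^ ((p-2)/p)) * this
  set A := (ν^2 * L) ^ (1/p) with hA
  set D := (2 * 10 ^ (1/p)) * M ^ (2/p) * B * t ^ (1/p) * (ν * G) ^ ((p-2)/p) with hD
  have hA0 : 0 ≤ A := by positivity
  have hD0 : 0 ≤ D := by positivity
  have hconj : p.HolderConjugate (p/(p-1)) := Real.HolderConjugate.conjExponent (by linarith)
  have hy := Real.young_inequality_of_nonneg hA0 hD0 hconj
  have hAp : A ^ p = ν^2 * L := by
    rw [hA, ← Real.rpow_mul (by positivity), one_div_mul_cancel hp0.ne', Real.rpow_one]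
  have hDq : D ^ (p/(p-1)) = (2 * 10 ^ (1/p)) ^ (p/(p-1)) * M ^ (2/(p-1)) * B ^ (p/(p-1))
      * t ^ (1/(p-1)) * (ν * G) ^ ((p-2)/(p-1)) := by
    rw [hD, Real.mul_rpow (by positivity) (by positivity), Real.mul_rpow (by positivity) (by positivity),
      Real.mul_rpow (by positivity) (by positivity), Real.mul_rpow (by positivity) (by positivity),
      ← Real.rpow_mul hM, ← Real.rpow_mul ht, ← Real.rpow_mul (by positivity)]
    have x1 : 2/p * (p/(p-1)) = 2/(p-1) := by field_simp
    have x2 : 1/p * (p/(p-1)) = 1/(p-1) := by field_simp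
    have x3 : (p-2)/p * (p/(p-1)) = (p-2)/(p-1) := by field_simp
    rw [x1, x2, x3]
  have y1 : A ^ p / p ≤ ν^2 * L := by
    rw [hAp]; exact div_le_self (by positivity) (by linarith)
  have y2 : D ^ (p/(p-1)) / (p/(p-1)) ≤ D ^ (p/(p-1)) :=
    div_le_self (by positivity) hconj.symm.lt.le
  rw [← hDq]
  refine le_trans ?_ (hy.trans (add_le_add y1 y2))
  calc 2 * ν * (N ^ (1/p) * G ^ ((p-2)/p) * Q ^ (1/p))
      ≤ 2 * ν * ((t ^ (1/p) * B) * G ^ ((p-2)/p) * (10 ^ (1/p) * M ^ (2/p) * L ^ (1/p))) := by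
        gcongr
    _ = A * D := by
        rw [hD]
        linear_combination (-(2 * 10 ^ (1/p) * M ^ (2/p) * B * t ^ (1/p))) * c3

/-- pointwise bound on the stretching term -/
lemma stretch {b : EuclideanSpace ℝ (Fin d) → EuclideanSpace ℝ (Fin d)}
    {x : EuclideanSpace ℝ (Fin d)} (hb : DifferentiableAt ℝ b x)
    (u : EuclideanSpace ℝ (Fin d) → ℝ) :
    - ∑ i, ∑ j, dx i u x * dx i (fun y => b y j) x * dx j u x ≤ ‖fderiv ℝ b x‖ * gradSq u x := by
  let w : EuclideanSpace ℝ (Fin d) := WithLp.toLp 2 fun i => dx i u x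
  have hw : ∀ i, w i = dx i u x := fun i => rfl
  have hn : gradSq u x = ‖w‖ ^ 2 := by
    rw [EuclideanSpace.norm_sq_eq, gradSq_eq]
    exact Finset.sum_congr rfl fun i _ => by rw [hw, Real.norm_eq_abs, sq_abs, sq]
  have hcomp : ∀ i j, dx i (fun y => b y j) x = fderiv ℝ b x (EuclideanSpace.single i 1) j := by
    intro i j
    have h1 := ((EuclideanSpace.proj j : EuclideanSpace ℝ (Fin d) →L[ℝ] ℝ).hasFDerivAt
      (x := b x)).comp x hb.hasFDerivAt
    have h3 : fderiv ℝ (fun y => b y j) x = _ := h1.fderiv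
    unfold dx
    rw [h3]; rfl
  have hws : w = ∑ i, dx i u x • EuclideanSpace.single i (1:ℝ) := by
    ext k
    simp only [WithLp.ofLp_sum, Finset.sum_apply, PiLp.smul_apply, PiLp.single_apply]
    rw [Finset.sum_eq_single k]
    · simp [hw]
    · intro j _ hj; simp [hj.symm]
    · simp
  have hsum : ∑ i, ∑ j, dx i u x * dx i (fun y => b y j) x * dx j u x =
      inner ℝ (fderiv ℝ b x w) w := by
    rw [hws, map_sum, sum_inner, ← hws]
    refine Finset.sum_congr rfl fun i _ => ?_
    rw [map_smul, inner_smul_left, PiLp.inner_apply, Finset.mul_sum]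
    refine Finset.sum_congr rfl fun j _ => ?_
    rw [hcomp, hw]
    simp
    ring
  rw [hsum, hn]
  have h1 := abs_real_inner_le_norm (fderiv ℝ b x w) w
  have h2 := (fderiv ℝ b x).le_opNorm w
  have h3 := neg_abs_le (inner ℝ (fderiv ℝ b x w) w)
  nlinarith [mul_le_mul_of_nonneg_right h2 (norm_nonneg w)]

lemma energy {u v : EuclideanSpace ℝ (Fin d) → ℝ} (hu : Per u) (hv : Per v)
    {b : EuclideanSpace ℝ (Fin d) → EuclideanSpace ℝ (Fin d)} (hb : ContDiff ℝ (⊤ : ℕ∞) b)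
    (hbp : ∀ x i, b (x + EuclideanSpace.single i 1) = b x)
    (hdiv : ∀ x, ∑ i, dx i (fun y => b y i) x = 0) {ν : ℝ}
    (heq : ∀ x, v x + ∑ i, b x i * dx i u x = ν * lap u x) :
    ∫ x in torusBox d, 2 * ∑ i, dx i u x * dx i v x ≤
      -(2 * ν) * (∫ x in torusBox d, (lap u x)^2)
        + 2 * ∫ x in torusBox d, ‖fderiv ℝ b x‖ * gradSq u x := by
  have hbj : ∀ j, Per (fun y => b y j) := fun j =>
    ⟨(EuclideanSpace.proj j : EuclideanSpace ℝ (Fin d) →L[ℝ] ℝ).contDiff.comp hb,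
      fun x i => by simp only [hbp]⟩
  have hl := hu.lap
  have hadv := adv hu hbj hdiv
  have e1 : ∫ x in torusBox d, 2 * ∑ i, dx i u x * dx i v x =
      - (2 * ∫ x in torusBox d, lap u x * v x) := by
    rw [integral_const_mul, ← mul_neg]
    congr 1
    simp only [lap_eq, Finset.sum_mul]
    rw [integral_finsetSum _ fun i _ => box_int ((hu.dx i).mul (hv.dx i)).cont,
      integral_finsetSum _ fun i _ => box_int (((hu.dx i).dx i).mul hv).cont,
      ← Finset.sum_neg_distrib]
    refine Finset.sum_congr rfl fun i _ => ?_
    rw [ibp (hu.dx i) hv, neg_neg]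
  have hs : Per (fun x => ∑ j, b x j * dx j u x) := Per.sum fun j => (hbj j).mul (hu.dx j)
  have e2 : ∫ x in torusBox d, lap u x * v x =
      ν * (∫ x in torusBox d, (lap u x)^2) -
        ∫ x in torusBox d, lap u x * ∑ j, b x j * dx j u x := by
    rw [← integral_const_mul, ← integral_sub]
    · congr 1
      ext x
      have := heq x
      linear_combination (lap u x) * this
    · exact box_int (continuous_const.mul (hl.cont.pow 2))
    · exact box_int (hl.mul hs).cont
  have hfc : Continuous (fderiv ℝ b) := hb.continuous_fderiv (by simp)
  have e3 : - ∫ x in torusBox d, ∑ i, ∑ j, dx i u x * dx i (fun y => b y j) x * dx j u x ≤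
      ∫ x in torusBox d, ‖fderiv ℝ b x‖ * gradSq u x := by
    rw [← integral_neg]
    refine setIntegral_mono ?_ ?_ fun x => stretch (hb.differentiable (by simp) x) u
    · exact box_int (Per.sum fun i => Per.sum fun j =>
        ((hu.dx i).mul ((hbj j).dx i)).mul (hu.dx j)).cont.neg
    · exact box_int (hfc.norm.mul hu.gradSq.cont)
  rw [e1, e2, hadv]
  linarith

lemma main_est (p : ℝ) (hp : 2 < p) {T ν : ℝ} (hν : 0 < ν)
    {b : ℝ → EuclideanSpace ℝ (Fin d) → EuclideanSpace ℝ (Fin d)}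
    {u : ℝ → EuclideanSpace ℝ (Fin d) → ℝ} {M B : ℝ} (hM : 0 ≤ M) (hB : 0 ≤ B)
    (hb : ContDiff ℝ (⊤ : ℕ∞) (fun q : ℝ × EuclideanSpace ℝ (Fin d) => b q.1 q.2))
    (hU : ContDiff ℝ (⊤ : ℕ∞) (fun q : ℝ × EuclideanSpace ℝ (Fin d) => u q.1 q.2))
    (hbp : ∀ t x i, b t (x + EuclideanSpace.single i 1) = b t x)
    (hup : ∀ t x i, u t (x + EuclideanSpace.single i 1) = u t x)
    (hdiv : ∀ t x, ∑ i, dx i (fun y => b t y i) x = 0)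
    (hu0 : ∀ x, |u 0 x| ≤ M)
    (hBp : ∀ t ∈ Set.Icc (0:ℝ) T, (∫ x in torusBox d, ‖fderiv ℝ (b t) x‖ ^ p) ^ (1/p) ≤ B)
    (heq : ∀ t ∈ Set.Icc (0:ℝ) T, ∀ x, deriv (fun s => u s x) t +
            ∑ i, b t x i * dx i (u t) x = ν * lap (u t) x)
    {t : ℝ} (ht : t ∈ Set.Icc (0:ℝ) T) :
    ν * (∫ x in torusBox d, gradSq (u t) x) +
            ν^2 * ∫ s in (0:ℝ)..t, ∫ x in torusBox d, (lap (u s) x)^2 ≤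
          ν * (∫ x in torusBox d, gradSq (u 0) x) +
            (2 * 10 ^ (1/p)) ^ (p/(p-1)) * M ^ (2/(p-1)) * B ^ (p/(p-1)) * t ^ (1/(p-1)) *
              (ν * ∫ s in (0:ℝ)..t, ∫ x in torusBox d, gradSq (u s) x) ^ ((p-2)/(p-1)) := by
  have hp0 : 0 < p := by linarith
  set U : ℝ × EuclideanSpace ℝ (Fin d) → ℝ := fun q => u q.1 q.2 with hUdef
  have hsub : ∀ s ∈ Set.Icc 0 t, s ∈ Set.Icc 0 T := fun s hs => ⟨hs.1, hs.2.trans ht.2⟩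
  have slice : ∀ {V : ℝ × EuclideanSpace ℝ (Fin d) → ℝ}, ContDiff ℝ (⊤ : ℕ∞) V → ∀ s,
      ContDiff ℝ (⊤ : ℕ∞) (fun x => V (s, x)) := fun hV s =>
    hV.comp (contDiff_const.prodMk contDiff_id)
  have perU : ∀ s, Per (u s) := fun s => ⟨slice hU s, hup s⟩
  have hstU := sm_st hU
  have hderiv : ∀ s x, deriv (fun r => u r x) s = st U (s, x) := fun s x =>
    (st_hasDeriv hU s x).deriv
  have perV : ∀ s, Per (fun x => st U (s, x)) := fun s =>
    ⟨slice hstU s, fun x i => by rw [← hderiv, ← hderiv]; simp only [hup]⟩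
  have hdxU : ∀ i s x, dx i (u s) x = sx i U (s, x) := fun i s x => dx_sx hU i s x
  have hddU : ∀ i s x, dx i (dx i (u s)) x = sx i (sx i U) (s, x) := by
    intro i s x
    have : dx i (u s) = fun y => sx i U (s, y) := funext fun y => hdxU i s y
    rw [this, dx_sx (sm_sx hU i)]
  have hlap : ∀ s x, lap (u s) x = ∑ i, sx i (sx i U) (s, x) := fun s x => by
    rw [lap_eq]; simp only [hddU]
  have hgr : ∀ s x, gradSq (u s) x = ∑ i, sx i U (s, x) * sx i U (s, x) := fun s x => by
    rw [gradSq_eq]; simp only [hdxU]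
  have bsm : ∀ s, ContDiff ℝ (⊤ : ℕ∞) (b s) := fun s =>
    hb.comp (contDiff_const.prodMk contDiff_id)
  -- maximum principle
  have hmax : ∀ s ∈ Set.Icc 0 T, ∀ x, |u s x| ≤ M := by
    have hpde : ∀ s ∈ Set.Icc 0 T, ∀ x, st U (s, x) + ∑ i, b s x i * sx i U (s, x) =
        ν * ∑ i, sx i (sx i U) (s, x) := by
      intro s hs x
      have := heq s hs x
      rw [hderiv, hlap] at this
      simpa only [hdxU] using this
    have up := maxp hU (fun s x i => hup s x i) hν (fun s x i => b s x i) hpde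
      (fun x => (abs_le.1 (hu0 x)).2)
    have nsx : ∀ (V : ℝ × EuclideanSpace ℝ (Fin d) → ℝ) i, sx i (fun q => - V q) = fun q => - sx i V q := by
      intro V i; ext q; unfold sx; rw [fderiv_fun_neg]; simp
    have nst : ∀ (V : ℝ × EuclideanSpace ℝ (Fin d) → ℝ), st (fun q => - V q) = fun q => - st V q := by
      intro V; ext q; unfold st; rw [fderiv_fun_neg]; simp
    have lo := maxp (U := fun q => - U q) hU.neg (fun s x i => congrArg Neg.neg (hup s x i)) hν
      (fun s x i => b s x i) (M := M) (T := T) (by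
        intro s hs x
        simp only [nsx, nst, mul_neg, Finset.sum_neg_distrib]
        have := hpde s hs x
        linarith) (fun x => by
        have := (abs_le.1 (hu0 x)).1
        show - u 0 x ≤ M
        linarith)
    intro s hs x
    have h1 : u s x ≤ M := up s hs x
    have h2 : - u s x ≤ M := lo s hs x
    exact abs_le.2 ⟨by linarith, h1⟩
  -- space-time functions
  let g : ℝ × EuclideanSpace ℝ (Fin d) → ℝ := fun q => gradSq (u q.1) q.2
  let l : ℝ × EuclideanSpace ℝ (Fin d) → ℝ := fun q => lap (u q.1) q.2
  let n : ℝ × EuclideanSpace ℝ (Fin d) → ℝ := fun q => ‖fderiv ℝ (b q.1) q.2‖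
  have gsm : ContDiff ℝ (⊤ : ℕ∞) g := by
    have : g = fun q => ∑ i, sx i U q * sx i U q := funext fun q => hgr q.1 q.2
    rw [this]
    exact ContDiff.sum fun i _ => (sm_sx hU i).mul (sm_sx hU i)
  have gc : Continuous g := gsm.continuous
  have lc : Continuous l := by
    have : l = fun q => ∑ i, sx i (sx i U) q := funext fun q => hlap q.1 q.2
    rw [this]
    exact (ContDiff.sum fun i _ => sm_sx (sm_sx hU i) i : ContDiff ℝ (⊤ : ℕ∞) _).continuous
  have nc : Continuous n := by
    have hfd : ∀ q : ℝ × EuclideanSpace ℝ (Fin d), fderiv ℝ (b q.1) q.2 =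
        (fderiv ℝ (fun q : ℝ × EuclideanSpace ℝ (Fin d) => b q.1 q.2) q).comp
          (ContinuousLinearMap.inr ℝ ℝ (EuclideanSpace ℝ (Fin d))) := by
      intro q
      have h1 : HasFDerivAt (fun y : EuclideanSpace ℝ (Fin d) => (q.1, y))
        (ContinuousLinearMap.inr ℝ ℝ (EuclideanSpace ℝ (Fin d))) q.2 := hasFDerivAt_prodMk_right q.1 q.2
      exact ((hb.differentiable (by simp) q).hasFDerivAt.comp q.2 h1).fderiv
    have : n = fun q => ‖(fderiv ℝ (fun q : ℝ × EuclideanSpace ℝ (Fin d) => b q.1 q.2) q).comp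
          (ContinuousLinearMap.inr ℝ ℝ (EuclideanSpace ℝ (Fin d)))‖ := funext fun q => by
      simp only [n, hfd]
    rw [this]
    have h2 := hb.continuous_fderiv (by simp)
    exact (h2.clm_comp continuous_const).norm
  have g0 : ∀ q, 0 ≤ g q := fun q => Finset.sum_nonneg fun i _ => sq_nonneg _
  have n0 : ∀ q, 0 ≤ n q := fun q => norm_nonneg _
  have l2c : Continuous (fun q => l q ^ 2) := lc.pow 2
  have g2c : Continuous (fun q => g q ^ 2) := gc.pow 2
  have ngc : Continuous (fun q => n q * g q) := nc.mul gc
  have npc : Continuous (fun q => n q ^ p) := nc.rpow_const fun _ => Or.inr hp0.le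
  -- energy
  have hstg : ∀ s x, st g (s, x) = 2 * ∑ i, dx i (u s) x * dx i (fun y => st U (s, y)) x := by
    intro s x
    rw [← (st_hasDeriv gsm s x).deriv]
    have h1 : HasDerivAt (fun r => ∑ i, sx i U (r, x) * sx i U (r, x))
      (∑ i, (st (sx i U) (s, x) * sx i U (s, x) + sx i U (s, x) * st (sx i U) (s, x))) s :=
      HasDerivAt.fun_sum fun i _ =>
        (st_hasDeriv (sm_sx hU i) s x).mul (st_hasDeriv (sm_sx hU i) s x)
    have h2 : (fun r => g (r, x)) = fun r => ∑ i, sx i U (r, x) * sx i U (r, x) :=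
      funext fun r => hgr r x
    rw [h2, h1.deriv, Finset.mul_sum]
    refine Finset.sum_congr rfl fun i _ => ?_
    rw [hdxU, dx_sx hstU, st_sx hU]; ring
  have hen : ∀ s ∈ Set.Icc 0 t, ∫ x in torusBox d, st g (s, x) ≤
      -(2 * ν) * (∫ x in torusBox d, l (s, x)^2) + 2 * ∫ x in torusBox d, n (s, x) * g (s, x) := by
    intro s hs
    simp only [hstg]
    refine energy (perU s) (perV s) (bsm s) (hbp s) (hdiv s) fun x => ?_
    rw [← hderiv]
    exact heq s (hsub s hs) x
  have hE : (∫ x in torusBox d, g (t, x)) - ∫ x in torusBox d, g (0, x) ≤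
      -(2 * ν) * (∫ q, l q ^ 2 ∂(stm d t)) + 2 * ∫ q, n q * g q ∂(stm d t) := by
    rw [ftc gsm ht.1, ← stm_eq l2c ht.1, ← stm_eq ngc ht.1, ← intervalIntegral.integral_const_mul,
      ← intervalIntegral.integral_const_mul, ← intervalIntegral.integral_add
        ((slice_int l2c ht.1).const_mul _) ((slice_int ngc ht.1).const_mul _)]
    exact intervalIntegral.integral_mono_on ht.1 (slice_int (sm_st gsm).continuous ht.1)
      (((slice_int l2c ht.1).const_mul _).add ((slice_int ngc ht.1).const_mul _)) hen
  -- Hölder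
  have hH : ∫ q, n q * g q ∂(stm d t) ≤ (∫ q, n q ^ p ∂(stm d t)) ^ (1/p) *
      (∫ q, g q ∂(stm d t)) ^ ((p-2)/p) * (∫ q, g q ^ 2 ∂(stm d t)) ^ (1/p) := by
    have := holder3 (stm_int npc t) (stm_int gc t) (stm_int g2c t)
      (fun q => Real.rpow_nonneg (n0 q) p) g0 (fun q => sq_nonneg _)
      (a := 1/p) (b := (p-2)/p) (c := 1/p) (by positivity)
      (div_nonneg (by linarith) hp0.le) (by positivity) (by field_simp; ring)
    refine le_trans (le_of_eq ?_) this
    congr 1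
    ext q
    rw [← Real.rpow_mul (n0 q), mul_one_div_cancel hp0.ne', Real.rpow_one,
      ← Real.rpow_natCast_mul (g0 q), mul_assoc, ← Real.rpow_add_of_nonneg (g0 q)
        (div_nonneg (by linarith) hp0.le) (by positivity)]
    have : (p-2)/p + ((2:ℕ):ℝ) * (1/p) = 1 := by push_cast; field_simp; ring
    rw [this, Real.rpow_one]
  have hN : ∫ q, n q ^ p ∂(stm d t) ≤ t * B ^ p := by
    rw [← stm_eq npc ht.1]
    have h1 := intervalIntegral.integral_mono_on ht.1 (slice_int npc ht.1)
      (intervalIntegrable_const (c := B ^ p)) (fun s hs => by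
        have h3 := hBp s (hsub s hs)
        have h4 : 0 ≤ ∫ x in torusBox d, ‖fderiv ℝ (b s) x‖ ^ p :=
          integral_nonneg fun x => by positivity
        have h5 := Real.rpow_le_rpow (by positivity) h3 hp0.le
        rw [← Real.rpow_mul h4, one_div_mul_cancel hp0.ne', Real.rpow_one] at h5
        exact h5)
    simpa using h1
  have hQ : ∫ q, g q ^ 2 ∂(stm d t) ≤ 10 * M^2 * ∫ q, l q ^ 2 ∂(stm d t) := by
    rw [← stm_eq g2c ht.1, ← stm_eq l2c ht.1, ← intervalIntegral.integral_const_mul]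
    exact intervalIntegral.integral_mono_on ht.1 (slice_int g2c ht.1)
      ((slice_int l2c ht.1).const_mul _) fun s hs => gn (perU s) (hmax s (hsub s hs))
  have hfin := final_alg hp hν ht.1 hB hM
    (integral_nonneg fun q => Real.rpow_nonneg (n0 q) p) (integral_nonneg (μ := stm d t) g0)
    (integral_nonneg fun q => sq_nonneg (g q)) (integral_nonneg fun q => sq_nonneg (l q)) hN hQ
  have eL : ∫ s in (0:ℝ)..t, ∫ x in torusBox d, (lap (u s) x)^2 = ∫ q, l q ^ 2 ∂(stm d t) :=
    stm_eq l2c ht.1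
  have eG : ∫ s in (0:ℝ)..t, ∫ x in torusBox d, gradSq (u s) x = ∫ q, g q ∂(stm d t) :=
    stm_eq gc ht.1
  rw [eL, eG]
  have h1 : ν * ((∫ x in torusBox d, gradSq (u t) x) - ∫ x in torusBox d, gradSq (u 0) x) ≤
      ν * (-(2 * ν) * (∫ q, l q ^ 2 ∂(stm d t)) + 2 * ∫ q, n q * g q ∂(stm d t)) :=
    mul_le_mul_of_nonneg_left hE hν.le
  have h2 := mul_le_mul_of_nonneg_left hH (by positivity : (0:ℝ) ≤ 2 * ν)
  linarith [h1, h2, hfin]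

end AD

/-- a priori bound on `ν‖∇u^ν_t‖² + ν²∫_0^t ‖Δu^ν_s‖² ds` in terms of
the energy dissipation, for divergence free `b ∈ L^∞_t W^{1,p}_x`, `p > 2`. -/
theorem stmt10 (d : ℕ) (p : ℝ) (hp : 2 < p) :
    ∃ C : ℝ, 0 < C ∧
      ∀ (T ν : ℝ), 0 < T → 0 < ν →
      ∀ (b : ℝ → EuclideanSpace ℝ (Fin d) → EuclideanSpace ℝ (Fin d))
        (uν : ℝ → EuclideanSpace ℝ (Fin d) → ℝ) (M₀ B : ℝ),
        0 ≤ M₀ → 0 ≤ B →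
        ContDiff ℝ (⊤ : ℕ∞) (fun q : ℝ × EuclideanSpace ℝ (Fin d) => b q.1 q.2) →
        ContDiff ℝ (⊤ : ℕ∞) (fun q : ℝ × EuclideanSpace ℝ (Fin d) => uν q.1 q.2) →
        (∀ t x i, b t (x + EuclideanSpace.single i 1) = b t x) →
        (∀ t x i, uν t (x + EuclideanSpace.single i 1) = uν t x) →
        -- b is divergence free
        (∀ t x, ∑ i, fderiv ℝ (fun y => b t y i) x (EuclideanSpace.single i 1) = 0) →
        -- ‖u₀‖_{L^∞} ≤ M₀
        (∀ x, |uν 0 x| ≤ M₀) →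
        -- ‖∇b‖_{L^∞_t L^p_x} ≤ B
        (∀ t ∈ Set.Icc (0:ℝ) T,
          (∫ x in torusBox d, ‖fderiv ℝ (b t) x‖ ^ p) ^ (1/p) ≤ B) →
        -- u^ν solves the advection-diffusion equation
        (∀ t ∈ Set.Icc (0:ℝ) T, ∀ x,
          deriv (fun s => uν s x) t +
            ∑ i, b t x i * fderiv ℝ (uν t) x (EuclideanSpace.single i 1) =
              ν * lap (uν t) x) →
        ∀ t ∈ Set.Icc (0:ℝ) T,
          ν * (∫ x in torusBox d, gradSq (uν t) x) +
            ν^2 * ∫ s in (0:ℝ)..t, ∫ x in torusBox d, (lap (uν s) x)^2 ≤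
          ν * (∫ x in torusBox d, gradSq (uν 0) x) +
            C * M₀ ^ (2/(p-1)) * B ^ (p/(p-1)) * t ^ (1/(p-1)) *
              (ν * ∫ s in (0:ℝ)..t, ∫ x in torusBox d, gradSq (uν s) x) ^ ((p-2)/(p-1)) := by
  refine ⟨(2 * 10 ^ (1/p)) ^ (p/(p-1)), by positivity, ?_⟩
  intro T ν _ hν b u M B hM hB hb hu hbp hup hdiv hu0 hBp heq t ht
  exact AD.main_est p hp hν hM hB hb hu hbp hup hdiv hu0 hBp heq ht
end
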